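/- Under the abstract model of the reduction network with single-edge robust decodability at the b-cut and the a-side structure with the vector map a injective on G: for every i ∈ Fin k and every plurality predictor π_i of a_i from b_i over G, if |A_err| ≤ E_a and |B_err| ≤ E_b then |{m ∈ G : π_i (b_i m) ≠ a_i m}| ≤ E_a + 2·E_b. (Paper's Lemma 2: with E_a = E_b = ε·2^{kn} this gives |M^π_i| ≤ 3ε·2^{kn}.) -/

import Mathlib

open Classical in
/-- The number of words with `i`-th coordinate in `S` depends only on the size of `S`. -/
lemma card_coord_eq {k N : ℕ} (i : Fin k) (S T : Finset (Fin N)) (h : S.card = T.card) :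
    (Finset.univ.filter (fun w : Fin k → Fin N => w i ∈ S)).card =
    (Finset.univ.filter (fun w : Fin k → Fin N => w i ∈ T)).card := by
  have key : ∀ U : Finset (Fin N), Finset.univ.filter (fun w : Fin k → Fin N => w i ∈ U) =
      Fintype.piFinset (fun j => if j = i then U else Finset.univ) := by
    intro U
    ext w
    simp only [Finset.mem_filter, Finset.mem_univ, true_and, Fintype.mem_piFinset]
    constructor
    · intro hw j
      by_cases hj : j = i
      · subst hj; simpa using hw
      · simp [hj]
    · intro hw
      simpa using hw i
  rw [key, key, Fintype.card_piFinset, Fintype.card_piFinset]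
  apply Finset.prod_congr rfl
  intro j _
  by_cases hj : j = i
  · simp [hj, h]
  · simp [hj]

/-- Words outside the image of an injective map. -/
lemma card_err_add {M W : Type} [Fintype W] [DecidableEq W] (G : Finset M)
    (c : M → W) (hc : ∀ m₁ ∈ G, ∀ m₂ ∈ G, c m₁ = c m₂ → m₁ = m₂)
    [DecidablePred (fun w : W => ∀ m ∈ G, w ≠ c m)] :
    (Finset.univ.filter (fun w : W => ∀ m ∈ G, w ≠ c m)).card + G.card = Fintype.card W := by
  have h1 : Finset.univ.filter (fun w : W => ∀ m ∈ G, w ≠ c m) = (G.image c)ᶜ := by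
    ext w
    simp only [Finset.mem_filter, Finset.mem_univ, true_and, Finset.mem_compl, Finset.mem_image,
      not_exists, not_and]
    exact ⟨fun h m hm e => h m hm e.symm, fun h m hm e => h m hm e.symm⟩
  have h2 : (G.image c).card = G.card :=
    Finset.card_image_of_injOn (fun m₁ h₁ m₂ h₂ e => hc m₁ h₁ m₂ h₂ e)
  rw [h1, ← h2, Finset.card_compl_add_card]

/-- The plurality predictor errs no more often than any other predictor. -/
lemma plurality_le {M : Type} {N : ℕ} (G : Finset M) (a b : M → Fin N) (π h : Fin N → Fin N)
    (hπ : ∀ β α, (G.filter (fun m => b m = β ∧ a m = α)).card ≤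
      (G.filter (fun m => b m = β ∧ a m = π β)).card) :
    (G.filter (fun m => π (b m) ≠ a m)).card ≤ (G.filter (fun m => h (b m) ≠ a m)).card := by
  have e : ∀ p : Fin N → Fin N, (G.filter (fun m => p (b m) = a m)).card =
      ∑ β, (G.filter (fun m => b m = β ∧ a m = p β)).card := by
    intro p
    rw [Finset.card_eq_sum_card_fiberwise (f := b) (t := Finset.univ) (by intro _ _; simp)]
    apply Finset.sum_congr rfl
    intro β _
    rw [Finset.filter_filter]
    congr 1
    apply Finset.filter_congr
    intro m _
    constructor
    · rintro ⟨h1, h2⟩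
      exact ⟨h2, by rw [← h1, h2]⟩
    · rintro ⟨h1, h2⟩
      exact ⟨by rw [h2, h1], h1⟩
  have h1 := Finset.card_filter_add_card_filter_not (s := G) (fun m => π (b m) = a m)
  have h2 := Finset.card_filter_add_card_filter_not (s := G) (fun m => h (b m) = a m)
  have h3 : (G.filter (fun m => h (b m) = a m)).card ≤ (G.filter (fun m => π (b m) = a m)).card := by
    rw [e, e]
    exact Finset.sum_le_sum (fun β _ => hπ β _)
  simp only [ne_eq]
  omega

/-- Paper's Lemma 2: under single-edge robust decodability at the b-cut,
the a-side structure with the vector map `a` injective on `G`, any plurality predictor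
`π` of `a_i` from `b_i` over `G` errs on at most `E_a + 2·E_b` good messages, where
`|A_err| ≤ E_a` and `|B_err| ≤ E_b`. -/
theorem lemma_two_pi_error_bound
    (k N : ℕ) (hk : 1 ≤ k) (hN : 1 ≤ N)
    (M : Type) [Fintype M] [DecidableEq M]
    (G : Finset M)
    (x y z' b : Fin k → M → Fin N)
    (f : Fin k → Fin N → Fin N → Fin N → Fin N)
    (bv : M → Fin k → Fin N)
    (D : (Fin k → Fin N) → M)
    (hb : ∀ i m, b i m = f i (x i m) (y i m) (z' i m))
    (hbv : ∀ m i, bv m i = b i m)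
    (hdec : ∀ m ∈ G, D (bv m) = m)
    (hdecx : ∀ m ∈ G, ∀ i v,
      D (Function.update (bv m) i (f i v (y i m) (z' i m))) = m)
    (hdecy : ∀ m ∈ G, ∀ i v,
      D (Function.update (bv m) i (f i (x i m) v (z' i m))) = m)
    (hdecz : ∀ m ∈ G, ∀ i v,
      D (Function.update (bv m) i (f i (x i m) (y i m) v)) = m)
    (a : Fin k → M → Fin N) (ξ η : Fin k → Fin N → Fin N)
    (hx : ∀ i m, x i m = ξ i (a i m))
    (hy : ∀ i m, y i m = η i (a i m))
    (av : M → Fin k → Fin N)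
    (hav : ∀ m i, av m i = a i m)
    (hainj : ∀ m₁ ∈ G, ∀ m₂ ∈ G, av m₁ = av m₂ → m₁ = m₂)
    (E_a E_b : ℕ)
    (hEa : (Finset.univ.filter (fun w : Fin k → Fin N => ∀ m ∈ G, w ≠ av m)).card ≤ E_a)
    (hEb : (Finset.univ.filter (fun w : Fin k → Fin N => ∀ m ∈ G, w ≠ bv m)).card ≤ E_b)
    (i : Fin k) (π : Fin N → Fin N)
    (hπ : ∀ β α,
      (G.filter (fun m => b i m = β ∧ a i m = α)).card ≤
      (G.filter (fun m => b i m = β ∧ a i m = π β)).card) :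
    (G.filter (fun m => π (b i m) ≠ a i m)).card ≤ E_a + 2 * E_b := by
  classical
  have hbinj : ∀ m₁ ∈ G, ∀ m₂ ∈ G, bv m₁ = bv m₂ → m₁ = m₂ := by
    intro m₁ h₁ m₂ h₂ e
    rw [← hdec m₁ h₁, ← hdec m₂ h₂, e]
  set Berr := Finset.univ.filter (fun w : Fin k → Fin N => ∀ m ∈ G, w ≠ bv m) with hBerr
  have hBA : Berr.card ≤ E_a := by
    have h1 := card_err_add G av hainj
    have h2 := card_err_add G bv hbinj
    rw [← hBerr] at h2
    omega
  -- rigid messages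
  let rigid : M → Prop := fun m =>
    (∀ v, f i v (y i m) (z' i m) = b i m) ∧ (∀ v, f i (x i m) v (z' i m) = b i m) ∧
    (∀ v, f i (x i m) (y i m) v = b i m)
  have hupd : ∀ m ∈ G, ∀ c : Fin N, D (Function.update (bv m) i c) = m → c ≠ b i m →
      ∃ w ∈ Berr, D w = m := by
    intro m hm c hD hc
    refine ⟨_, ?_, hD⟩
    simp only [hBerr, Finset.mem_filter, Finset.mem_univ, true_and]
    intro m' hm' e
    have : m' = m := by rw [← hD, e, hdec m' hm']
    subst this
    apply hc
    have := congrFun e i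
    simpa [hbv] using this
  have hnr : ∀ m ∈ G.filter (fun m => ¬ rigid m), ∃ w ∈ Berr, D w = m := by
    intro m hm
    obtain ⟨hm, hr⟩ := Finset.mem_filter.1 hm
    by_contra hcon
    apply hr
    refine ⟨fun v => ?_, fun v => ?_, fun v => ?_⟩
    · by_contra hne
      exact hcon (hupd m hm _ (hdecx m hm i v) hne)
    · by_contra hne
      exact hcon (hupd m hm _ (hdecy m hm i v) hne)
    · by_contra hne
      exact hcon (hupd m hm _ (hdecz m hm i v) hne)
  have hNR : (G.filter (fun m => ¬ rigid m)).card ≤ Berr.card := by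
    have hsub : G.filter (fun m => ¬ rigid m) ⊆ Berr.image D := by
      intro m hm
      exact Finset.mem_image.2 (hnr m hm)
    exact (Finset.card_le_card hsub).trans Finset.card_image_le
  -- among rigid messages, `a` determines `b`
  have hdet : ∀ m₁ m₂, rigid m₁ → rigid m₂ → a i m₁ = a i m₂ → b i m₁ = b i m₂ := by
    intro m₁ m₂ h₁ h₂ e
    have hxx : x i m₁ = x i m₂ := by rw [hx, hx, e]
    rw [← h₁.2.1 (y i m₂), ← h₂.2.2 (z' i m₁), hxx]
  let I : Finset (Fin N) := (G.filter rigid).image (b i)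
  have hch : ∀ β : Fin N, ∃ α : Fin N, β ∈ I → ∃ m, rigid m ∧ b i m = β ∧ a i m = α := by
    intro β
    by_cases hβ : β ∈ I
    · obtain ⟨m, hm, e⟩ := Finset.mem_image.1 hβ
      exact ⟨a i m, fun _ => ⟨m, (Finset.mem_filter.1 hm).2, e, rfl⟩⟩
    · exact ⟨β, fun h => absurd h hβ⟩
  choose h hh using hch
  have hinj : Set.InjOn h I := by
    intro β₁ h₁ β₂ h₂ e
    obtain ⟨m₁, r₁, e₁, e₁'⟩ := hh β₁ h₁
    obtain ⟨m₂, r₂, e₂, e₂'⟩ := hh β₂ h₂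
    rw [← e₁, ← e₂]
    exact hdet _ _ r₁ r₂ (by rw [e₁', e₂', e])
  have hcI : ((I.image h)ᶜ).card = (Iᶜ).card := by
    rw [Finset.card_compl, Finset.card_compl, Finset.card_image_of_injOn hinj]
  have hw := card_coord_eq i _ _ hcI
  have hwI : (Finset.univ.filter (fun w : Fin k → Fin N => w i ∈ Iᶜ)).card ≤
      Berr.card + (G.filter (fun m => ¬ rigid m)).card := by
    have hsub : Finset.univ.filter (fun w : Fin k → Fin N => w i ∈ Iᶜ) ⊆
        Berr ∪ (G.filter (fun m => ¬ rigid m)).image bv := by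
      intro w hw
      have hw := (Finset.mem_filter.1 hw).2
      by_cases hB : w ∈ Berr
      · exact Finset.mem_union_left _ hB
      · apply Finset.mem_union_right
        simp only [hBerr, Finset.mem_filter, Finset.mem_univ, true_and, not_forall,
          not_not] at hB
        obtain ⟨m, hm, e⟩ := hB
        refine Finset.mem_image.2 ⟨m, Finset.mem_filter.2 ⟨hm, fun hr => ?_⟩, e.symm⟩
        apply Finset.mem_compl.1 hw
        exact Finset.mem_image.2 ⟨m, Finset.mem_filter.2 ⟨hm, hr⟩, by rw [e, hbv]⟩
    refine (Finset.card_le_card hsub).trans ((Finset.card_union_le _ _).trans ?_)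
    exact Nat.add_le_add_left Finset.card_image_le _
  have hR : ((G.filter rigid).filter (fun m => h (b i m) ≠ a i m)).card ≤
      (Finset.univ.filter (fun w : Fin k → Fin N => w i ∈ (I.image h)ᶜ)).card := by
    apply Finset.card_le_card_of_injOn av
    · intro m hm
      obtain ⟨hm, hne⟩ := Finset.mem_filter.1 hm
      have hr := (Finset.mem_filter.1 hm).2
      refine Finset.mem_filter.2 ⟨Finset.mem_univ _, Finset.mem_compl.2 fun hmem => ?_⟩
      obtain ⟨β, hβ, e⟩ := Finset.mem_image.1 hmem
      obtain ⟨m', r', e₁, e₂⟩ := hh β hβ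
      rw [hav] at e
      have := hdet m' m r' hr (by rw [e₂, e])
      apply hne
      rw [← this, e₁, e]
    · intro m₁ h₁ m₂ h₂ e
      exact hainj m₁ (Finset.mem_filter.1 (Finset.mem_filter.1 h₁).1).1 m₂
        (Finset.mem_filter.1 (Finset.mem_filter.1 h₂).1).1 e
  have htot : (G.filter (fun m => h (b i m) ≠ a i m)).card ≤
      ((G.filter rigid).filter (fun m => h (b i m) ≠ a i m)).card +
      (G.filter (fun m => ¬ rigid m)).card := by
    refine le_trans (Finset.card_le_card ?_) (Finset.card_union_le _ _)
    intro m hm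
    obtain ⟨hm, hne⟩ := Finset.mem_filter.1 hm
    by_cases hr : rigid m
    · exact Finset.mem_union_left _
        (Finset.mem_filter.2 ⟨Finset.mem_filter.2 ⟨hm, hr⟩, hne⟩)
    · exact Finset.mem_union_right _ (Finset.mem_filter.2 ⟨hm, hr⟩)
  have hpl := plurality_le G (a i) (b i) π h hπ
  omega
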